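/- arXiv:1507.01995 — 2 statements merged into one kernel-verified Lean document; each statement's English description precedes it below -/
import Mathlib

section
/- Let n ≥ 1 and 0 < ε ≤ 1/2. For every (a,b,x) ∈ ℝ × ℝ × ℝⁿ, one has μ_n({ξ ∈ ℝⁿ : a ≤ xᵀξ ≤ b}) ≥ 1 − ε if and only if there exists t ∈ ℝ with t ≥ ‖x‖₂ and (a, b, t) ∈ S̄_ε. That is, the two-sided chance constraint set is the projection onto (a,b,x) of the convex set {(a,b,x,t) : ‖x‖₂ ≤ t, (a,b,t) ∈ S̄_ε}. -/
open MeasureTheory ProbabilityTheory Set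

/-- The standard Gaussian CDF. -/
noncomputable def Phi (t : ℝ) : ℝ := ((gaussianReal 0 1) (Set.Iic t)).toReal

/-- The conic hull `S̄_ε` of the set `S_ε = {(x,y) : Φ(y) − Φ(x) ≥ 1 − ε}`. -/
noncomputable def Sbar (ε : ℝ) : Set (ℝ × ℝ × ℝ) :=
  closure {p : ℝ × ℝ × ℝ | 0 < p.2.2 ∧ Phi (p.2.1 / p.2.2) - Phi (p.1 / p.2.2) ≥ 1 - ε}

/-- The law of a vector of `n` i.i.d. standard Gaussian random variables. -/
noncomputable def stdGaussianPi (n : ℕ) : Measure (Fin n → ℝ) :=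
  Measure.pi fun _ => gaussianReal 0 1

theorem Phi_eq_cdf (t : ℝ) : Phi t = cdf (gaussianReal 0 1) t :=
  (cdf_eq_real _ t).symm

theorem monotone_Phi : Monotone Phi := by
  intro s t hst
  simpa only [Phi_eq_cdf] using monotone_cdf _ hst

theorem leftLim_cdf_gaussianReal (t : ℝ) :
    Function.leftLim (cdf (gaussianReal 0 1)) t = cdf (gaussianReal 0 1) t := by
  have := nullSingletonClass_gaussianReal (μ := 0) (v := 1) one_ne_zero
  have h := (cdf (gaussianReal 0 1)).measure_singleton t
  rw [measure_cdf, measure_singleton, eq_comm, ENNReal.ofReal_eq_zero] at h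
  exact le_antisymm ((monotone_cdf _).leftLim_le le_rfl) (by linarith)

theorem continuous_Phi : Continuous Phi := by
  have h : Continuous (cdf (gaussianReal 0 1)) := by
    rw [continuous_iff_continuousAt]
    intro t
    rw [(monotone_cdf _).continuousAt_iff_leftLim_eq_rightLim, leftLim_cdf_gaussianReal,
      StieltjesFunction.rightLim_eq]
  exact h.congr fun t => (Phi_eq_cdf t).symm

theorem gaussianReal_Icc (a b : ℝ) :
    gaussianReal 0 1 (Icc a b) = ENNReal.ofReal (Phi b - Phi a) := by
  rw [Phi_eq_cdf, Phi_eq_cdf, ← leftLim_cdf_gaussianReal a, ← StieltjesFunction.measure_Icc,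
    measure_cdf]

theorem Phi_neg (t : ℝ) : Phi (-t) = 1 - Phi t := by
  have hmap : gaussianReal 0 1 (Iic (-t)) = gaussianReal 0 1 (Ici t) := by
    have h := gaussianReal_map_neg (μ := 0) (v := 1)
    rw [neg_zero] at h
    conv_lhs => rw [← h, Measure.map_apply measurable_neg measurableSet_Iic]
    congr 1
    ext s
    simp
  have := nullSingletonClass_gaussianReal (μ := 0) (v := 1) one_ne_zero
  rw [Phi, hmap, ← measure_congr Ioi_ae_eq_Ici, ← compl_Iic, ← measureReal_def,
    probReal_compl_eq_one_sub measurableSet_Iic]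
  rfl

theorem Phi_zero : Phi 0 = 1 / 2 := by
  have := Phi_neg 0
  rw [neg_zero] at this
  linarith

theorem Phi_pos (t : ℝ) : 0 < Phi t := by
  refine ENNReal.toReal_pos (fun h => ?_) (measure_ne_top _ _)
  have := gaussianReal_absolutelyContinuous' 0 (v := 1) one_ne_zero h
  simp at this

theorem Phi_lt_one (t : ℝ) : Phi t < 1 := by
  have := Phi_pos (-t)
  rw [Phi_neg] at this
  linarith

theorem exists_Phi_sub_Phi_neg_ge {ε : ℝ} (hε : 0 < ε) :
    ∃ M : ℝ, Phi M - Phi (-M) ≥ 1 - ε := by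
  have h := tendsto_cdf_atTop (gaussianReal 0 1)
  obtain ⟨M, hM⟩ := (h.eventually (lt_mem_nhds (show 1 - ε / 2 < 1 by linarith))).exists
  rw [← Phi_eq_cdf] at hM
  exact ⟨M, by rw [Phi_neg]; linarith⟩

theorem nonpos_and_nonneg_of_Phi_sub_ge {ε x y : ℝ} (hε : ε ≤ 1 / 2)
    (h : Phi y - Phi x ≥ 1 - ε) : x ≤ 0 ∧ 0 ≤ y := by
  have hx := Phi_pos x
  have hy := Phi_lt_one y
  constructor <;> by_contra! hlt <;> have := monotone_Phi hlt.le <;> rw [Phi_zero] at this <;>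
    linarith

theorem map_sum_mul_stdGaussianPi {n : ℕ} (x : Fin n → ℝ) :
    (stdGaussianPi n).map (fun ξ => ∑ i, x i * ξ i) =
      (gaussianReal 0 1).map (fun z => Real.sqrt (∑ i, x i ^ 2) * z) := by
  have hm : Measurable fun ξ : Fin n → ℝ => ∑ i, x i * ξ i := by fun_prop
  unfold stdGaussianPi
  have := Measure.isProbabilityMeasure_map (μ := Measure.pi fun _ : Fin n => gaussianReal 0 1)
    hm.aemeasurable
  rw [gaussianReal_map_const_mul]
  apply Measure.ext_of_charFun
  have hind : iIndepFun (fun i (ξ : Fin n → ℝ) => x i * ξ i)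
      (Measure.pi fun _ : Fin n => gaussianReal 0 1) :=
    iIndepFun_pi (X := fun i z => x i * z) (fun i => by fun_prop)
  have hmap (i : Fin n) : (Measure.pi fun _ : Fin n => gaussianReal 0 1).map
      (fun ξ => x i * ξ i) = gaussianReal 0 (.mk (x i ^ 2) (sq_nonneg _)) := by
    have h := (measurePreserving_eval (fun _ : Fin n => gaussianReal 0 1) i).map_eq
    rw [← Function.comp_def (fun z => x i * z) (fun ξ : Fin n → ℝ => ξ i),
      ← Measure.map_map (by fun_prop) (by fun_prop)]
    erw [h]
    simp only [gaussianReal_map_const_mul, mul_zero, mul_one]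
  have hX (i : Fin n) : AEMeasurable (fun ξ : Fin n → ℝ => x i * ξ i)
      (Measure.pi fun _ : Fin n => gaussianReal 0 1) :=
    (measurable_const.mul (measurable_pi_apply i)).aemeasurable
  rw [hind.charFun_map_fun_sum_eq_prod hX]
  ext s
  have hs : Real.sqrt (∑ i, x i ^ 2) ^ 2 = ∑ i, x i ^ 2 :=
    Real.sq_sqrt (Finset.sum_nonneg fun i _ => sq_nonneg _)
  simp only [hmap, Finset.prod_apply, charFun_gaussianReal]
  rw [← Complex.exp_sum]
  simp [hs, Finset.sum_mul, Finset.sum_div]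

theorem stdGaussianPi_two_sided {n : ℕ} (a b : ℝ) (x : Fin n → ℝ) :
    stdGaussianPi n {ξ | a ≤ ∑ i, x i * ξ i ∧ ∑ i, x i * ξ i ≤ b} =
      gaussianReal 0 1 {z | a ≤ Real.sqrt (∑ i, x i ^ 2) * z ∧
        Real.sqrt (∑ i, x i ^ 2) * z ≤ b} := by
  have h := congrArg (fun μ => μ (Icc a b)) (map_sum_mul_stdGaussianPi x)
  rwa [Measure.map_apply (by fun_prop) measurableSet_Icc,
    Measure.map_apply (by fun_prop) measurableSet_Icc] at h

theorem gaussianReal_scaled_two_sided_ge_iff {ε σ : ℝ} (hσ : 0 < σ) (hε : ε < 1) (a b : ℝ) :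
    (gaussianReal 0 1 {z | a ≤ σ * z ∧ σ * z ≤ b}).toReal ≥ 1 - ε ↔
      Phi (b / σ) - Phi (a / σ) ≥ 1 - ε := by
  have : {z | a ≤ σ * z ∧ σ * z ≤ b} = Icc (a / σ) (b / σ) := by
    ext z
    simp only [mem_ofPred_eq, mem_Icc, div_le_iff₀' hσ, le_div_iff₀' hσ]
  rw [this, gaussianReal_Icc, ENNReal.toReal_ofReal']
  simp [hε.not_ge]

theorem gaussianReal_degenerate_two_sided_ge_iff {ε : ℝ} (hε0 : 0 ≤ ε) (hε : ε < 1) (a b : ℝ) :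
    (gaussianReal 0 1 {z : ℝ | a ≤ 0 * z ∧ 0 * z ≤ b}).toReal ≥ 1 - ε ↔ a ≤ 0 ∧ 0 ≤ b := by
  by_cases h : a ≤ 0 ∧ 0 ≤ b
  · simp [h, hε0]
  · simp [h, hε]

theorem sign_and_Phi_sub_ge_of_mem_Sbar {ε : ℝ} (hε : ε ≤ 1 / 2) {a b t : ℝ} (h : (a, b, t) ∈ Sbar ε) :
    a ≤ 0 ∧ 0 ≤ b ∧ (0 < t → Phi (b / t) - Phi (a / t) ≥ 1 - ε) := by
  have hsub : {p : ℝ × ℝ × ℝ | 0 < p.2.2 ∧ Phi (p.2.1 / p.2.2) - Phi (p.1 / p.2.2) ≥ 1 - ε} ⊆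
      {p | p.1 ≤ 0} ∩ {p | 0 ≤ p.2.1} := by
    rintro p ⟨hp, hPhi⟩
    have hxy := nonpos_and_nonneg_of_Phi_sub_ge hε hPhi
    exact ⟨by simpa using (div_le_iff₀ hp).1 hxy.1, by simpa using (le_div_iff₀ hp).1 hxy.2⟩
  have hclosed : IsClosed ({p : ℝ × ℝ × ℝ | p.1 ≤ 0} ∩ {p | 0 ≤ p.2.1}) :=
    (isClosed_le continuous_fst continuous_const).inter
      (isClosed_le continuous_const (continuous_fst.comp continuous_snd))
  obtain ⟨ha, hb⟩ := closure_minimal hsub hclosed h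
  refine ⟨ha, hb, fun ht => ?_⟩
  · have hcont : ContinuousAt (fun p : ℝ × ℝ × ℝ => Phi (p.2.1 / p.2.2) - Phi (p.1 / p.2.2))
        (a, b, t) := by
      refine ContinuousAt.sub (continuous_Phi.continuousAt.comp ?_)
        (continuous_Phi.continuousAt.comp ?_)
      all_goals exact ContinuousAt.div (by fun_prop) (by fun_prop) ht.ne'
    obtain ⟨u, hu, hlim⟩ := mem_closure_iff_seq_limit.1 h
    exact ge_of_tendsto' (hcont.tendsto.comp hlim) fun k => (hu k).2

theorem mem_Sbar_zero {ε a b : ℝ} (hε : 0 < ε) (ha : a ≤ 0) (hb : 0 ≤ b) :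
    (a, b, 0) ∈ Sbar ε := by
  obtain ⟨M, hM⟩ := exists_Phi_sub_Phi_neg_ge hε
  have hlim : Filter.Tendsto (fun d : ℝ => (a - d * M, b + d * M, d)) (nhdsWithin 0 (Ioi 0))
      (nhds (a, b, 0)) := by
    have : Continuous fun d : ℝ => (a - d * M, b + d * M, d) := by fun_prop
    simpa using (this.tendsto 0).mono_left nhdsWithin_le_nhds
  refine mem_closure_of_tendsto hlim ?_
  filter_upwards [self_mem_nhdsWithin] with d (hd : 0 < d)
  refine ⟨hd, ?_⟩
  have h1 : Phi M ≤ Phi ((b + d * M) / d) := monotone_Phi <| by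
    rw [le_div_iff₀ hd]; linarith
  have h2 : Phi ((a - d * M) / d) ≤ Phi (-M) := monotone_Phi <| by
    rw [div_le_iff₀ hd]; linarith
  exact hM.le.trans (sub_le_sub h1 h2)

/-- `P(a ≤ xᵀξ ≤ b) ≥ 1 − ε` iff there is `t ≥ ‖x‖₂` with `(a,b,t) ∈ S̄_ε`. -/
theorem stmt4 (n : ℕ) (hn : 1 ≤ n) (ε : ℝ) (hε0 : 0 < ε) (hε : ε ≤ 1 / 2)
    (a b : ℝ) (x : Fin n → ℝ) :
    ((stdGaussianPi n) {ξ : Fin n → ℝ |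
        a ≤ ∑ i, x i * ξ i ∧ ∑ i, x i * ξ i ≤ b}).toReal ≥ 1 - ε ↔
      ∃ t : ℝ, Real.sqrt (∑ i, (x i) ^ 2) ≤ t ∧ (a, b, t) ∈ Sbar ε := by
  have hε1 : ε < 1 := by linarith
  rw [stdGaussianPi_two_sided]
  rcases (Real.sqrt_nonneg (∑ i, x i ^ 2)).eq_or_lt with hσ | hσ
  · rw [← hσ, gaussianReal_degenerate_two_sided_ge_iff hε0.le hε1]
    constructor
    · rintro ⟨ha, hb⟩
      exact ⟨0, le_rfl, mem_Sbar_zero hε0 ha hb⟩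
    · rintro ⟨t, -, h⟩
      obtain ⟨ha, hb, -⟩ := sign_and_Phi_sub_ge_of_mem_Sbar hε h
      exact ⟨ha, hb⟩
  · rw [gaussianReal_scaled_two_sided_ge_iff hσ hε1]
    constructor
    · exact fun h => ⟨_, le_rfl, subset_closure ⟨hσ, h⟩⟩
    · rintro ⟨t, hσt, h⟩
      obtain ⟨ha, hb, hPhi⟩ := sign_and_Phi_sub_ge_of_mem_Sbar hε h
      have ht := hPhi (hσ.trans_le hσt)
      have h1 := monotone_Phi (div_le_div_of_nonneg_left hb hσ hσt)
      have h2 := monotone_Phi ((div_le_div_iff₀ hσ (hσ.trans_le hσt)).2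
        (mul_le_mul_of_nonpos_left hσt ha))
      linarith
end

section
/- Let n ≥ 1, 0 < ε ≤ 1/2, let μ ∈ ℝⁿ, and let L be any n × n real matrix. The set C_{μ,L} = {(a,b,x) ∈ ℝ × ℝ × ℝⁿ : μ_n({ζ ∈ ℝⁿ : a ≤ xᵀ(Lζ + μ) ≤ b}) ≥ 1 − ε} is convex. (This is the two-sided chance constraint P(a ≤ xᵀξ ≤ b) ≥ 1−ε for a jointly Gaussian vector ξ = Lζ + μ with mean μ and covariance LLᵀ.) -/
open MeasureTheory ProbabilityTheory Set

/-- A linear functional of a standard Gaussian vector is distributed as the norm of its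
coefficient vector times a standard Gaussian variable. -/
lemma map_sum_mul_pi_gaussianReal {ι : Type*} [Fintype ι] (c : EuclideanSpace ℝ ι) :
    (Measure.pi fun _ : ι => gaussianReal 0 1).map (fun ζ => ∑ i, c i * ζ i) =
      (gaussianReal 0 1).map (fun z => ‖c‖ * z) := by
  have hmeas : Measurable (fun ζ : ι → ℝ => ∑ i, c i * ζ i) :=
    Finset.measurable_sum _ fun i _ => (measurable_const_mul (c i : ℝ)).comp (measurable_pi_apply i)
  have : IsProbabilityMeasure
      ((Measure.pi fun _ : ι => gaussianReal 0 1).map (fun ζ => ∑ i, c i * ζ i)) :=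
    Measure.isProbabilityMeasure_map hmeas.aemeasurable
  rw [gaussianReal_map_const_mul]
  apply Measure.ext_of_charFun
  ext t
  rw [charFun_gaussianReal, charFun_apply_real, integral_map hmeas.aemeasurable (by fun_prop)]
  have key (ζ : ι → ℝ) : Complex.exp (t * ((∑ i, c i * ζ i : ℝ) : ℂ) * Complex.I) =
      ∏ i, Complex.exp (((t * c i : ℝ) : ℂ) * ζ i * Complex.I) := by
    rw [← Complex.exp_sum]
    push_cast
    rw [Finset.mul_sum, Finset.sum_mul]
    congr 1
    exact Finset.sum_congr rfl fun i _ => by ring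
  simp_rw [key]
  rw [integral_fintype_prod_eq_prod
    (f := fun i (x : ℝ) => Complex.exp (((t * c i : ℝ) : ℂ) * x * Complex.I))]
  simp_rw [← charFun_apply_real, charFun_gaussianReal]
  rw [← Complex.exp_sum]
  congr 1
  have h : ((‖c‖ ^ 2 : ℝ) : ℂ) = ∑ i, (c i : ℂ) ^ 2 := by
    rw [EuclideanSpace.real_norm_sq_eq]
    push_cast
    rfl
  push_cast at h
  simp only [mul_zero, Complex.ofReal_zero, zero_mul, zero_sub, NNReal.coe_one,
    Complex.ofReal_one, one_mul, mul_one, NNReal.coe_mk, Complex.ofReal_pow,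
    Complex.ofReal_mul]
  rw [h, Finset.sum_mul, Finset.sum_div, ← Finset.sum_neg_distrib]
  exact Finset.sum_congr rfl fun i _ => by ring

lemma antitoneOn_gaussianPDFReal : AntitoneOn (gaussianPDFReal 0 1) (Ici 0) := by
  intro x hx y _ hxy
  have hx' : (0 : ℝ) ≤ x := hx
  simp only [gaussianPDFReal, sub_zero]
  gcongr

lemma gaussianReal_real_Icc {a b : ℝ} (hab : a ≤ b) :
    (gaussianReal 0 1).real (Icc a b) = ∫ x in a..b, gaussianPDFReal 0 1 x := by
  rw [measureReal_def, gaussianReal_apply_eq_integral 0 one_ne_zero, ENNReal.toReal_ofReal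
    (integral_nonneg fun x => gaussianPDFReal_nonneg 0 1 x), integral_Icc_eq_integral_Ioc,
    intervalIntegral.integral_of_le hab]

lemma intervalIntegrable_gaussianPDFReal (a b : ℝ) :
    IntervalIntegrable (gaussianPDFReal 0 1) volume a b :=
  (integrable_gaussianPDFReal 0 1).intervalIntegrable

lemma continuous_gaussianPDFReal : Continuous (gaussianPDFReal 0 1) := by
  unfold gaussianPDFReal
  fun_prop

lemma concaveOn_integral_gaussianPDFReal :
    ConcaveOn ℝ (Ici 0) (fun u : ℝ => ∫ x in (0 : ℝ)..u, gaussianPDFReal 0 1 x) := by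
  have hd (u : ℝ) : HasDerivAt (fun u : ℝ => ∫ x in (0 : ℝ)..u, gaussianPDFReal 0 1 x)
      (gaussianPDFReal 0 1 u) u :=
    continuous_gaussianPDFReal.integral_hasStrictDerivAt 0 u |>.hasDerivAt
  refine AntitoneOn.concaveOn_of_deriv (convex_Ici 0)
    (fun u _ => (hd u).continuousAt.continuousWithinAt)
    (fun u _ => (hd u).differentiableAt.differentiableWithinAt) ?_
  rw [funext fun u => (hd u).deriv]
  exact antitoneOn_gaussianPDFReal.mono interior_subset

lemma gaussianReal_real_Icc_neg {u v : ℝ} (hu : 0 ≤ u) (hv : 0 ≤ v) :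
    (gaussianReal 0 1).real (Icc (-u) v) =
      (∫ x in (0 : ℝ)..u, gaussianPDFReal 0 1 x) + ∫ x in (0 : ℝ)..v, gaussianPDFReal 0 1 x := by
  rw [gaussianReal_real_Icc (by linarith),
    ← intervalIntegral.integral_add_adjacent_intervals (b := 0)
      (intervalIntegrable_gaussianPDFReal _ _) (intervalIntegrable_gaussianPDFReal _ _)]
  congr 1
  have h := intervalIntegral.integral_comp_neg (a := 0) (b := u) (gaussianPDFReal 0 1)
  rw [neg_zero] at h
  rw [← h]
  congr 1
  ext x
  simp [gaussianPDFReal]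

/-- The probability that a centred Gaussian variable of standard deviation `s` lies in the
interval `[-A, B]`. -/
noncomputable def gaussianIntervalProb (s A B : ℝ) : ℝ :=
  (gaussianReal 0 1).real {z | -A ≤ s * z ∧ s * z ≤ B}

lemma gaussianIntervalProb_eq_Icc {s : ℝ} (hs : 0 < s) (A B : ℝ) :
    gaussianIntervalProb s A B = (gaussianReal 0 1).real (Icc (-(A / s)) (B / s)) := by
  unfold gaussianIntervalProb
  congr 1
  ext z
  simp only [mem_ofPred_eq, mem_Icc, ← neg_div, div_le_iff₀ hs, le_div_iff₀ hs, mul_comm z]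

lemma gaussianIntervalProb_swap (s A B : ℝ) :
    gaussianIntervalProb s A B = gaussianIntervalProb s B A := by
  unfold gaussianIntervalProb
  have hm : MeasurableSet {z : ℝ | -A ≤ s * z ∧ s * z ≤ B} := by measurability
  have h : (gaussianReal 0 1).map (fun x => -x) = gaussianReal 0 1 := by
    rw [gaussianReal_map_neg, neg_zero]
  conv_lhs => rw [← h]
  rw [map_measureReal_apply (by fun_prop) hm]
  congr 1
  ext z
  simp only [mem_preimage, mem_ofPred_eq, mul_neg]
  constructor <;> rintro ⟨h₁, h₂⟩ <;> constructor <;> linarith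

lemma gaussianReal_real_Ici_lt_half {c : ℝ} (hc : 0 < c) :
    (gaussianReal 0 1).real (Ici c) < 1 / 2 := by
  have hneg : (gaussianReal 0 1).real (Iic (-c)) = (gaussianReal 0 1).real (Ici c) := by
    have h : (gaussianReal 0 1).map (fun x => -x) = gaussianReal 0 1 := by
      rw [gaussianReal_map_neg, neg_zero]
    conv_lhs => rw [← h]
    rw [map_measureReal_apply (by fun_prop) measurableSet_Iic]
    congr 1
    ext z
    simp
  have hpos : 0 < (gaussianReal 0 1).real (Ioo (-c) c) := by
    rw [measureReal_def, ENNReal.toReal_pos_iff]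
    refine ⟨pos_iff_ne_zero.2 fun h0 => ?_, measure_lt_top _ _⟩
    have := gaussianReal_absolutelyContinuous' 0 one_ne_zero h0
    rw [Real.volume_Ioo, ENNReal.ofReal_eq_zero] at this
    linarith
  have h1 : (gaussianReal 0 1).real (Iic (-c) ∪ Ioo (-c) c) =
      (gaussianReal 0 1).real (Iic (-c)) + (gaussianReal 0 1).real (Ioo (-c) c) :=
    measureReal_union (disjoint_left.2 fun x hx hx' => not_lt.2 hx hx'.1) measurableSet_Ioo
  have h2 : (gaussianReal 0 1).real ((Iic (-c) ∪ Ioo (-c) c) ∪ Ici c) =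
      (gaussianReal 0 1).real (Iic (-c) ∪ Ioo (-c) c) + (gaussianReal 0 1).real (Ici c) := by
    refine measureReal_union (disjoint_left.2 fun x hx hx' => ?_) measurableSet_Ici
    have hx'' : c ≤ x := hx'
    rcases hx with hx | hx
    · have : x ≤ -c := hx
      linarith
    · exact not_lt.2 hx'' hx.2
  have h3 : (gaussianReal 0 1).real ((Iic (-c) ∪ Ioo (-c) c) ∪ Ici c) ≤ 1 := measureReal_le_one
  linarith

lemma nonneg_of_half_le_gaussianIntervalProb {s A B : ℝ} (hs : 0 ≤ s)
    (h : 1 / 2 ≤ gaussianIntervalProb s A B) : 0 ≤ A := by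
  by_contra! hA
  rcases hs.eq_or_lt with rfl | hs
  · have h0 : {z : ℝ | -A ≤ 0 * z ∧ 0 * z ≤ B} = ∅ := by
      ext z
      simp only [zero_mul, mem_ofPred_eq, mem_empty_iff_false, iff_false]
      intro h
      linarith [h.1]
    rw [gaussianIntervalProb, h0, measureReal_empty] at h
    norm_num at h
  · rw [gaussianIntervalProb_eq_Icc hs] at h
    have hc : 0 < -(A / s) := neg_pos.2 (div_neg_of_neg_of_pos hA hs)
    have := measureReal_mono (μ := gaussianReal 0 1)
      (Icc_subset_Ici_self : Icc (-(A / s)) (B / s) ⊆ _)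
    linarith [gaussianReal_real_Ici_lt_half hc]

lemma gaussianIntervalProb_mono {s s' A A' B B' : ℝ} (hs : 0 ≤ s) (hss : s ≤ s')
    (hA : 0 ≤ A) (hB : 0 ≤ B) (hAA : A ≤ A') (hBB : B ≤ B') :
    gaussianIntervalProb s' A B ≤ gaussianIntervalProb s A' B' := by
  refine measureReal_mono fun z hz => ?_
  obtain ⟨h1, h2⟩ := hz
  rcases le_total 0 z with hz | hz
  · exact ⟨by nlinarith [mul_nonneg hs hz], by nlinarith⟩
  · exact ⟨by nlinarith, by nlinarith [mul_nonneg hs (neg_nonneg.2 hz)]⟩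

lemma gaussianIntervalProb_smul {t : ℝ} (ht : 0 < t) (s A B : ℝ) :
    gaussianIntervalProb (t * s) (t * A) (t * B) = gaussianIntervalProb s A B := by
  unfold gaussianIntervalProb
  congr 1
  ext z
  simp only [mem_ofPred_eq, mul_assoc, ← mul_neg, mul_le_mul_iff_right₀ ht]

lemma le_gaussianIntervalProb_add_of_pos {p s₁ s₂ A₁ A₂ B₁ B₂ : ℝ} (hs₁ : 0 < s₁)
    (hs₂ : 0 < s₂) (hA₁ : 0 ≤ A₁) (hA₂ : 0 ≤ A₂) (hB₁ : 0 ≤ B₁) (hB₂ : 0 ≤ B₂)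
    (h₁ : p ≤ gaussianIntervalProb s₁ A₁ B₁) (h₂ : p ≤ gaussianIntervalProb s₂ A₂ B₂) :
    p ≤ gaussianIntervalProb (s₁ + s₂) (A₁ + A₂) (B₁ + B₂) := by
  have hs : 0 < s₁ + s₂ := by positivity
  rw [gaussianIntervalProb_eq_Icc hs₁, gaussianReal_real_Icc_neg (by positivity)
    (by positivity)] at h₁
  rw [gaussianIntervalProb_eq_Icc hs₂, gaussianReal_real_Icc_neg (by positivity)
    (by positivity)] at h₂
  rw [gaussianIntervalProb_eq_Icc hs, gaussianReal_real_Icc_neg (by positivity) (by positivity)]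
  have hw₁ : 0 ≤ s₁ / (s₁ + s₂) := by positivity
  have hw₂ : 0 ≤ s₂ / (s₁ + s₂) := by positivity
  have hw : s₁ / (s₁ + s₂) + s₂ / (s₁ + s₂) = 1 := by field_simp
  have comb (x y : ℝ) : s₁ / (s₁ + s₂) * (x / s₁) + s₂ / (s₁ + s₂) * (y / s₂) =
      (x + y) / (s₁ + s₂) := by field_simp
  have conc {x y : ℝ} (hx : 0 ≤ x) (hy : 0 ≤ y) :=
    concaveOn_integral_gaussianPDFReal.2 (mem_Ici.2 (div_nonneg hx hs₁.le))
      (mem_Ici.2 (div_nonneg hy hs₂.le)) hw₁ hw₂ hw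
  have hA := conc hA₁ hA₂
  have hB := conc hB₁ hB₂
  simp only [smul_eq_mul, comb] at hA hB
  calc p = s₁ / (s₁ + s₂) * p + s₂ / (s₁ + s₂) * p := by rw [← add_mul, hw, one_mul]
    _ ≤ _ := add_le_add (mul_le_mul_of_nonneg_left h₁ hw₁) (mul_le_mul_of_nonneg_left h₂ hw₂)
    _ ≤ _ := by linarith

lemma le_gaussianIntervalProb_add {p s₁ s₂ A₁ A₂ B₁ B₂ : ℝ} (hp : 1 / 2 ≤ p) (hs₁ : 0 ≤ s₁)
    (hs₂ : 0 ≤ s₂) (h₁ : p ≤ gaussianIntervalProb s₁ A₁ B₁)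
    (h₂ : p ≤ gaussianIntervalProb s₂ A₂ B₂) :
    p ≤ gaussianIntervalProb (s₁ + s₂) (A₁ + A₂) (B₁ + B₂) := by
  have hA₁ := nonneg_of_half_le_gaussianIntervalProb hs₁ (hp.trans h₁)
  have hA₂ := nonneg_of_half_le_gaussianIntervalProb hs₂ (hp.trans h₂)
  have hB₁ := nonneg_of_half_le_gaussianIntervalProb hs₁
    ((hp.trans h₁).trans_eq (gaussianIntervalProb_swap _ _ _))
  have hB₂ := nonneg_of_half_le_gaussianIntervalProb hs₂
    ((hp.trans h₂).trans_eq (gaussianIntervalProb_swap _ _ _))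
  rcases hs₁.eq_or_lt with rfl | hs₁
  · exact h₂.trans (gaussianIntervalProb_mono (by simpa) (by simp) hA₂ hB₂ (by simpa) (by simpa))
  rcases hs₂.eq_or_lt with rfl | hs₂
  · exact h₁.trans
      (gaussianIntervalProb_mono (by simpa using hs₁.le) (by simp) hA₁ hB₁ (by simpa) (by simpa))
  exact le_gaussianIntervalProb_add_of_pos hs₁ hs₂ hA₁ hA₂ hB₁ hB₂ h₁ h₂

lemma stdGaussianPi_toReal_eq (n : ℕ) (μ : Fin n → ℝ) (L : Matrix (Fin n) (Fin n) ℝ)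
    (a b : ℝ) (x : Fin n → ℝ) :
    ((stdGaussianPi n) {ζ : Fin n → ℝ |
      a ≤ ∑ i, x i * (L.mulVec ζ + μ) i ∧ ∑ i, x i * (L.mulVec ζ + μ) i ≤ b}).toReal =
    gaussianIntervalProb ‖WithLp.toLp 2 (Matrix.vecMul x L)‖ (x ⬝ᵥ μ - a) (b - x ⬝ᵥ μ) := by
  have hsum (ζ : Fin n → ℝ) : ∑ i, x i * (L.mulVec ζ + μ) i =
      ∑ i, (WithLp.toLp 2 (Matrix.vecMul x L)) i * ζ i + x ⬝ᵥ μ := by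
    change x ⬝ᵥ (L.mulVec ζ + μ) = Matrix.vecMul x L ⬝ᵥ ζ + x ⬝ᵥ μ
    rw [dotProduct_add, Matrix.dotProduct_mulVec]
  have hm : MeasurableSet {y : ℝ | -(x ⬝ᵥ μ - a) ≤ y ∧ y ≤ b - x ⬝ᵥ μ} := measurableSet_Icc
  have h := congrArg (fun ν : Measure ℝ => ν.real {y : ℝ | -(x ⬝ᵥ μ - a) ≤ y ∧ y ≤ b - x ⬝ᵥ μ})
    (map_sum_mul_pi_gaussianReal (WithLp.toLp 2 (Matrix.vecMul x L)))
  simp only at h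
  rw [map_measureReal_apply (by fun_prop) hm, map_measureReal_apply (by fun_prop) hm] at h
  refine Eq.trans ?_ h
  rw [← measureReal_def, stdGaussianPi]
  congr 1
  ext ζ
  simp only [mem_ofPred_eq, mem_preimage, hsum]
  constructor <;> rintro ⟨h₁, h₂⟩ <;> constructor <;> linarith

/-- The two-sided chance constraint set `{(a,b,x) : P(a ≤ xᵀ(Lζ + μ) ≤ b) ≥ 1 − ε}` for a
jointly Gaussian vector `ξ = Lζ + μ` with mean `μ` and covariance `LLᵀ` is convex. -/
theorem stmt5 (n : ℕ) (hn : 1 ≤ n) (ε : ℝ) (hε0 : 0 < ε) (hε : ε ≤ 1 / 2)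
    (μ : Fin n → ℝ) (L : Matrix (Fin n) (Fin n) ℝ) :
    Convex ℝ {p : ℝ × ℝ × (Fin n → ℝ) |
      ((stdGaussianPi n) {ζ : Fin n → ℝ |
        p.1 ≤ ∑ i, p.2.2 i * (L.mulVec ζ + μ) i ∧
          ∑ i, p.2.2 i * (L.mulVec ζ + μ) i ≤ p.2.1}).toReal ≥ 1 - ε} := by
  simp_rw [stdGaussianPi_toReal_eq, ge_iff_le]
  rw [convex_iff_forall_pos]
  rintro ⟨a₁, b₁, x₁⟩ h₁ ⟨a₂, b₂, x₂⟩ h₂ t₁ t₂ ht₁ ht₂ -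
  simp only [mem_ofPred_eq, Prod.smul_mk, Prod.mk_add_mk, smul_eq_mul] at h₁ h₂ ⊢
  have hp : 1 / 2 ≤ 1 - ε := by linarith
  rw [← gaussianIntervalProb_smul ht₁] at h₁
  rw [← gaussianIntervalProb_smul ht₂] at h₂
  have hs₁ := mul_nonneg ht₁.le (norm_nonneg (WithLp.toLp 2 (Matrix.vecMul x₁ L)))
  have hs₂ := mul_nonneg ht₂.le (norm_nonneg (WithLp.toLp 2 (Matrix.vecMul x₂ L)))
  have h := le_gaussianIntervalProb_add hp hs₁ hs₂ h₁ h₂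
  have hA := nonneg_of_half_le_gaussianIntervalProb (add_nonneg hs₁ hs₂) (hp.trans h)
  have hB := nonneg_of_half_le_gaussianIntervalProb (add_nonneg hs₁ hs₂)
    ((hp.trans h).trans_eq (gaussianIntervalProb_swap _ _ _))
  have hx : (t₁ • x₁ + t₂ • x₂) ⬝ᵥ μ = t₁ * (x₁ ⬝ᵥ μ) + t₂ * (x₂ ⬝ᵥ μ) := by
    rw [add_dotProduct, smul_dotProduct, smul_dotProduct, smul_eq_mul, smul_eq_mul]
  refine h.trans (gaussianIntervalProb_mono (norm_nonneg _) ?_ hA hB ?_ ?_)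
  · rw [Matrix.add_vecMul, Matrix.smul_vecMul, Matrix.smul_vecMul, WithLp.toLp_add,
      WithLp.toLp_smul, WithLp.toLp_smul]
    refine (norm_add_le _ _).trans_eq ?_
    rw [norm_smul, norm_smul, Real.norm_of_nonneg ht₁.le, Real.norm_of_nonneg ht₂.le]
  · rw [hx]
    linarith
  · rw [hx]
    linarith
end
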